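/- Let X = (Ω, ℱ, ℙ, τ) be a metric dynamical system and V a potential on Ω such that σ_s(0) := inf_{f ∈ 𝔽} 𝔼[ |∇f|²/(8f) + Vf ] > 0. Then Γ_V satisfies the triangle inequality: for all x, y ∈ ℝ^d, Γ_V(x+y) ≤ Γ_V(x) + Γ_V(y). -/

import Mathlib

open MeasureTheory Filter

noncomputable section

/-- `ℝ^d` with the Euclidean norm. -/
abbrev Rd (d : ℕ) := EuclideanSpace ℝ (Fin d)

variable {d : ℕ} {Ω : Type*} [MeasurableSpace Ω]

/-- The realisation `f_ω : ℝ^d → E`, `f_ω(x) = f(τ_x ω)`. -/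
def realise (τ : Rd d → Ω → Ω) {E : Type*} (f : Ω → E) (ω : Ω) : Rd d → E :=
  fun x => f (τ x ω)

/-- `(Ω, ℱ, ℙ, τ)` is a metric dynamical system: `ℙ` is a probability measure, `τ` is a
jointly measurable action of `(ℝ^d, +)` on `Ω` leaving `ℙ` invariant. -/
def IsMDS (P : Measure Ω) (τ : Rd d → Ω → Ω) : Prop :=
  IsProbabilityMeasure P ∧ Measurable (Function.uncurry τ) ∧
    (∀ x y ω, τ (x + y) ω = τ x (τ y ω)) ∧ (∀ ω, τ 0 ω = ω) ∧
    ∀ x, MeasurePreserving (τ x) P P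

/-- A potential: a nonnegative function in `L¹(ℙ)`. -/
def IsPotential (P : Measure Ω) (V : Ω → ℝ) : Prop :=
  Measurable V ∧ (∀ ω, 0 ≤ V ω) ∧ Integrable V P

/-- The space `𝔽`: probability densities `f ∈ L¹(ℙ)` with `𝔼f = 1`, bounded away from `0`,
all realisations smooth, and `sup_Ω |Dⁿf| < ∞` for all `n`. -/
def memF (P : Measure Ω) (τ : Rd d → Ω → Ω) (f : Ω → ℝ) : Prop :=
  Measurable f ∧ Integrable f P ∧ (∫ ω, f ω ∂P) = 1 ∧ (∃ c > 0, ∀ ω, c ≤ f ω) ∧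
    (∀ ω, ContDiff ℝ (⊤ : ℕ∞) (realise τ f ω)) ∧
    (∀ n : ℕ, ∃ C, ∀ ω, ‖iteratedFDeriv ℝ n (realise τ f ω) 0‖ ≤ C)

/-- The space `Φ_y`: vector fields `φ ∈ (L¹(ℙ))^d` with smooth realisations, all derivatives
uniformly bounded, `𝔼φ = y`, and divergence-free realisations. -/
def memPhi (P : Measure Ω) (τ : Rd d → Ω → Ω) (y : Rd d) (φ : Ω → Rd d) : Prop :=
  Measurable φ ∧ Integrable φ P ∧ (∫ ω, φ ω ∂P) = y ∧
    (∀ ω, ContDiff ℝ (⊤ : ℕ∞) (realise τ φ ω)) ∧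
    (∀ n : ℕ, ∃ C, ∀ ω, ‖iteratedFDeriv ℝ n (realise τ φ ω) 0‖ ≤ C) ∧
    (∀ ω x, (∑ i, fderiv ℝ (fun z => realise τ φ ω z i) x (EuclideanSpace.single i 1)) = 0)

/-- The energy term `∫ (|∇f|²/(8f) + Vf) dℙ`. -/
def energy (P : Measure Ω) (τ : Rd d → Ω → Ω) (V f : Ω → ℝ) : ℝ :=
  ∫ ω, (‖fderiv ℝ (realise τ f ω) 0‖ ^ 2 / (8 * f ω) + V ω * f ω) ∂P

/-- The transport term `inf_{φ ∈ Φ_y} ∫ |φ|²/(2f) dℙ`. -/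
def transport (P : Measure Ω) (τ : Rd d → Ω → Ω) (f : Ω → ℝ) (y : Rd d) : ℝ :=
  sInf {r | ∃ φ, memPhi P τ y φ ∧ r = ∫ ω, ‖φ ω‖ ^ 2 / (2 * f ω) ∂P}

/-- The variational functional
`Γ_V(y) = 2 inf_{f ∈ 𝔽} [ (∫ |∇f|²/(8f) + Vf dℙ) (inf_{φ ∈ Φ_y} ∫ |φ|²/(2f) dℙ) ]^{1/2}`. -/
def Gamma (P : Measure Ω) (τ : Rd d → Ω → Ω) (V : Ω → ℝ) (y : Rd d) : ℝ :=
  2 * sInf {r | ∃ f, memF P τ f ∧ r = Real.sqrt (energy P τ V f * transport P τ f y)}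

end

theorem aux_sq {E : Type*} [SeminormedAddCommGroup E] (u v : E) {a b : ℝ} (ha : 0 < a)
    (hb : 0 < b) : ‖u + v‖ ^ 2 / (a + b) ≤ ‖u‖ ^ 2 / a + ‖v‖ ^ 2 / b := by
  have h1 : ‖u + v‖ ^ 2 ≤ (‖u‖ + ‖v‖) ^ 2 := by
    gcongr
    exact norm_add_le u v
  refine (div_le_div_of_nonneg_right h1 (by positivity)).trans ?_
  rw [div_add_div _ _ ha.ne' hb.ne', div_le_div_iff₀ (by positivity) (by positivity)]
  nlinarith [mul_nonneg (by positivity : (0:ℝ) ≤ a + b) (sq_nonneg (‖u‖ * b - ‖v‖ * a)),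
    sq_nonneg (‖u‖ * b - ‖v‖ * a)]

section aux
variable {d : ℕ} {Ω : Type*} [MeasurableSpace Ω] {P : Measure Ω} {τ : Rd d → Ω → Ω}

theorem memF_bdd (hX : IsMDS P τ) {f : Ω → ℝ} (hf : memF P τ f) : ∃ C, ∀ ω, |f ω| ≤ C := by
  obtain ⟨C, hC⟩ := hf.2.2.2.2.2 0
  refine ⟨C, fun ω => ?_⟩
  have := hC ω
  rwa [norm_iteratedFDeriv_zero, realise, hX.2.2.2.1, Real.norm_eq_abs] at this

theorem memPhi_bdd (hX : IsMDS P τ) {y : Rd d} {f : Ω → Rd d} (hf : memPhi P τ y f) :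
    ∃ C, ∀ ω, ‖f ω‖ ≤ C := by
  obtain ⟨C, hC⟩ := hf.2.2.2.2.1 0
  refine ⟨C, fun ω => ?_⟩
  have := hC ω
  rwa [norm_iteratedFDeriv_zero, realise, hX.2.2.2.1] at this

theorem memF_diff {f : Ω → ℝ} (hf : memF P τ f) (ω : Ω) (x : Rd d) :
    DifferentiableAt ℝ (realise τ f ω) x :=
  (hf.2.2.2.2.1 ω).differentiable (by simp) x

theorem memPhi_diff {y : Rd d} {f : Ω → Rd d} (hf : memPhi P τ y f) (ω : Ω) (x : Rd d) :
    DifferentiableAt ℝ (realise τ f ω) x :=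
  (hf.2.2.2.1 ω).differentiable (by simp) x

theorem memF_pos {f : Ω → ℝ} (hf : memF P τ f) (ω : Ω) : 0 < f ω := by
  obtain ⟨c, hc, h⟩ := hf.2.2.2.1
  exact hc.trans_le (h ω)

theorem meas_tau (hX : IsMDS P τ) (x : Rd d) : Measurable (τ x) :=
  hX.2.1.comp measurable_prodMk_left

theorem meas_dir (hX : IsMDS P τ) {f : Ω → ℝ} (hf : memF P τ f) (v : Rd d) :
    Measurable fun ω => fderiv ℝ (realise τ f ω) 0 v := by
  have hlim : ∀ ω, Tendsto (fun n : ℕ => (n : ℝ) • (f (τ ((n : ℝ)⁻¹ • v) ω) - f ω)) atTop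
      (nhds (fderiv ℝ (realise τ f ω) 0 v)) := by
    intro ω
    have h := (memF_diff hf ω 0).hasFDerivAt
    have h2 := (h.lim_real v).comp tendsto_natCast_atTop_atTop
    simpa [realise, hX.2.2.2.1, Function.comp_def] using h2
  refine measurable_of_tendsto_metrizable (f := fun (n : ℕ) ω =>
    (n : ℝ) • (f (τ ((n : ℝ)⁻¹ • v) ω) - f ω)) (fun n => ?_) (tendsto_pi_nhds.2 hlim)
  exact Measurable.const_smul ((hf.1.comp (meas_tau hX ((n : ℝ)⁻¹ • v))).sub hf.1) (n : ℝ)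

theorem meas_fderiv (hX : IsMDS P τ) {f : Ω → ℝ} (hf : memF P τ f) :
    Measurable fun ω => ‖fderiv ℝ (realise τ f ω) 0‖ := by
  have : ∀ ω, fderiv ℝ (realise τ f ω) 0 = ∑ i : Fin d,
      (fderiv ℝ (realise τ f ω) 0 (EuclideanSpace.single i 1)) •
        (EuclideanSpace.proj i : Rd d →L[ℝ] ℝ) := by
    intro ω
    ext v
    have hv : v = ∑ i : Fin d, v i • (EuclideanSpace.single i (1:ℝ) : Rd d) := by
      ext j
      simp [Finset.sum_apply, Pi.single_apply]
    conv_lhs => rw [hv]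
    simp [mul_comm]
  have hc : Continuous fun c : Fin d → ℝ => ‖∑ i : Fin d, c i •
      (EuclideanSpace.proj i : Rd d →L[ℝ] ℝ)‖ := by fun_prop
  have h2 := hc.measurable.comp (measurable_pi_lambda (fun ω (i : Fin d) =>
    fderiv ℝ (realise τ f ω) 0 (EuclideanSpace.single i 1)) fun i => meas_dir hX hf _)
  refine (congrArg Measurable (funext fun ω => ?_)).mpr h2
  exact congrArg norm (this ω)

theorem int_grad (hX : IsMDS P τ) {f : Ω → ℝ} (hf : memF P τ f) :
    Integrable (fun ω => ‖fderiv ℝ (realise τ f ω) 0‖ ^ 2 / (8 * f ω)) P := by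
  have := hX.1
  obtain ⟨c, hc, h⟩ := hf.2.2.2.1
  obtain ⟨C, hC⟩ := hf.2.2.2.2.2 1
  refine Integrable.of_bound (((meas_fderiv hX hf).pow_const 2).div
    (hf.1.const_mul 8)).aestronglyMeasurable (C ^ 2 / (8 * c)) (ae_of_all _ fun ω => ?_)
  have h1 := hC ω
  rw [norm_iteratedFDeriv_one] at h1
  have := memF_pos hf ω
  rw [Real.norm_of_nonneg (by positivity)]
  have := h ω
  gcongr

theorem int_pot (hX : IsMDS P τ) {V : Ω → ℝ} (hV : IsPotential P V) {f : Ω → ℝ}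
    (hf : memF P τ f) : Integrable (fun ω => V ω * f ω) P := by
  obtain ⟨C, hC⟩ := memF_bdd hX hf
  exact hV.2.2.mul_bdd (c := C) hf.1.aestronglyMeasurable (ae_of_all _ hC)

theorem int_phi (hX : IsMDS P τ) {f : Ω → ℝ} (hf : memF P τ f) {y : Rd d} {φ : Ω → Rd d}
    (hφ : memPhi P τ y φ) : Integrable (fun ω => ‖φ ω‖ ^ 2 / (2 * f ω)) P := by
  have := hX.1
  obtain ⟨c, hc, h⟩ := hf.2.2.2.1
  obtain ⟨C, hC⟩ := memPhi_bdd hX hφ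
  refine Integrable.of_bound ((hφ.1.norm.pow_const 2).div
    (hf.1.const_mul 2)).aestronglyMeasurable (C ^ 2 / (2 * c)) (ae_of_all _ fun ω => ?_)
  have := memF_pos hf ω
  rw [Real.norm_of_nonneg (by positivity)]
  have := h ω
  have := hC ω
  gcongr

theorem energy_nonneg {V : Ω → ℝ} (hV : IsPotential P V) {f : Ω → ℝ}
    (hf : memF P τ f) : 0 ≤ energy P τ V f := by
  refine integral_nonneg fun ω => ?_
  have := memF_pos hf ω
  have := hV.2.1 ω
  simp only [Pi.zero_apply]
  positivity

theorem trans_nonneg {f : Ω → ℝ} (hf : memF P τ f) {r : ℝ} {y : Rd d}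
    (hr : r ∈ {r | ∃ φ, memPhi P τ y φ ∧ r = ∫ ω, ‖φ ω‖ ^ 2 / (2 * f ω) ∂P}) : 0 ≤ r := by
  obtain ⟨φ, hφ, rfl⟩ := hr
  refine integral_nonneg fun ω => ?_
  have := memF_pos hf ω
  simp only [Pi.zero_apply]
  positivity

theorem realise_comb (f g : Ω → ℝ) (l m : ℝ) (ω : Ω) :
    realise τ (fun ω => l * f ω + m * g ω) ω = l • realise τ f ω + m • realise τ g ω := by
  ext x; simp [realise]

theorem memF_comb {f g : Ω → ℝ} (hf : memF P τ f) (hg : memF P τ g) {l m : ℝ}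
    (hl : 0 < l) (hm : 0 < m) (hlm : l + m = 1) :
    memF P τ (fun ω => l * f ω + m * g ω) := by
  obtain ⟨f1, f2, f3, ⟨c, hc, f4⟩, f5, f6⟩ := hf
  obtain ⟨g1, g2, g3, ⟨c', hc', g4⟩, g5, g6⟩ := hg
  refine ⟨(f1.const_mul l).add (g1.const_mul m), (f2.const_mul l).add (g2.const_mul m), ?_,
    ⟨l * c + m * c', by positivity, fun ω => ?_⟩, fun ω => ?_, fun n => ?_⟩
  · rw [integral_add (f2.const_mul l) (g2.const_mul m), integral_const_mul, integral_const_mul,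
      f3, g3]
    linarith
  · have := f4 ω
    have := g4 ω
    show l * c + m * c' ≤ l * f ω + m * g ω
    gcongr
  · rw [realise_comb]
    exact ((f5 ω).const_smul l).add ((g5 ω).const_smul m)
  · obtain ⟨C, hC⟩ := f6 n
    obtain ⟨C', hC'⟩ := g6 n
    refine ⟨l * C + m * C', fun ω => ?_⟩
    have hF := ((f5 ω).of_le (m := n) (by exact_mod_cast le_top)).contDiffAt (x := (0 : Rd d))
    have hG := ((g5 ω).of_le (m := n) (by exact_mod_cast le_top)).contDiffAt (x := (0 : Rd d))
    rw [realise_comb, iteratedFDeriv_add_apply (f := l • realise τ f ω)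
      (g := m • realise τ g ω) (hF.const_smul l) (hG.const_smul m),
      iteratedFDeriv_const_smul_apply hF, iteratedFDeriv_const_smul_apply hG]
    refine (norm_add_le _ _).trans ?_
    rw [norm_smul, norm_smul, Real.norm_of_nonneg hl.le, Real.norm_of_nonneg hm.le]
    have := hC ω
    have := hC' ω
    gcongr

theorem memPhi_add {x y : Rd d} {φ ψ : Ω → Rd d} (hφ : memPhi P τ x φ) (hψ : memPhi P τ y ψ) :
    memPhi P τ (x + y) (φ + ψ) := by
  have hr : ∀ ω, realise τ (φ + ψ) ω = realise τ φ ω + realise τ ψ ω := fun ω => rfl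
  have d1 := memPhi_diff hφ
  have d2 := memPhi_diff hψ
  obtain ⟨f1, f2, f3, f5, f6, f7⟩ := hφ
  obtain ⟨g1, g2, g3, g5, g6, g7⟩ := hψ
  refine ⟨f1.add g1, f2.add g2, ?_, fun ω => (f5 ω).add (g5 ω), fun n => ?_, fun ω z => ?_⟩
  · rw [integral_add' f2 g2, f3, g3]
  · obtain ⟨C, hC⟩ := f6 n
    obtain ⟨C', hC'⟩ := g6 n
    refine ⟨C + C', fun ω => ?_⟩
    have hF := ((f5 ω).of_le (m := n) (by exact_mod_cast le_top)).contDiffAt (x := (0 : Rd d))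
    have hG := ((g5 ω).of_le (m := n) (by exact_mod_cast le_top)).contDiffAt (x := (0 : Rd d))
    rw [hr, iteratedFDeriv_add_apply hF hG]
    exact (norm_add_le _ _).trans (add_le_add (hC ω) (hC' ω))
  · rw [← add_zero (0:ℝ)]
    nth_rewrite 1 [← f7 ω z]
    rw [← g7 ω z, ← Finset.sum_add_distrib]
    refine Finset.sum_congr rfl fun i _ => ?_
    have e1 : DifferentiableAt ℝ (fun z => realise τ φ ω z i) z := by
      have := d1 ω z
      fun_prop
    have e2 : DifferentiableAt ℝ (fun z => realise τ ψ ω z i) z := by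
      have := d2 ω z
      fun_prop
    have : (fun z => realise τ (φ + ψ) ω z i) =
      (fun z => realise τ φ ω z i) + fun z => realise τ ψ ω z i := rfl
    rw [this, fderiv_add e1 e2]
    rfl

theorem memPhi_const (hX : IsMDS P τ) (y : Rd d) : memPhi P τ y (fun _ => y) := by
  have := hX.1
  have hr : ∀ ω, realise τ (fun _ : Ω => y) ω = fun _ => y := fun ω => rfl
  refine ⟨measurable_const, integrable_const _, by simp, fun ω => contDiff_const, fun n => ?_,
    fun ω z => ?_⟩
  · refine ⟨‖iteratedFDeriv ℝ n (fun _ : Rd d => y) 0‖, fun ω => ?_⟩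
    rw [hr]
  · simp [hr]

theorem energy_comb (hX : IsMDS P τ) {V : Ω → ℝ} (hV : IsPotential P V) {f g : Ω → ℝ}
    (hf : memF P τ f) (hg : memF P τ g) {l m : ℝ}
    (hl : 0 < l) (hm : 0 < m) (hlm : l + m = 1) :
    energy P τ V (fun ω => l * f ω + m * g ω) ≤ l * energy P τ V f + m * energy P τ V g := by
  have hh := memF_comb hf hg hl hm hlm
  have i1 : Integrable (fun ω => l * (‖fderiv ℝ (realise τ f ω) 0‖ ^ 2 / (8 * f ω) +
      V ω * f ω)) P := ((int_grad hX hf).add (int_pot hX hV hf)).const_mul l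
  have i2 : Integrable (fun ω => m * (‖fderiv ℝ (realise τ g ω) 0‖ ^ 2 / (8 * g ω) +
      V ω * g ω)) P := ((int_grad hX hg).add (int_pot hX hV hg)).const_mul m
  unfold energy
  rw [← integral_const_mul, ← integral_const_mul, ← integral_add i1 i2]
  refine integral_mono ((int_grad hX hh).add (int_pot hX hV hh)) (i1.add i2) fun ω => ?_
  have hfp := memF_pos hf ω
  have hgp := memF_pos hg ω
  have key := aux_sq (l • fderiv ℝ (realise τ f ω) 0) (m • fderiv ℝ (realise τ g ω) 0)
    (a := l * (8 * f ω)) (b := m * (8 * g ω)) (by positivity) (by positivity)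
  have hfd : fderiv ℝ (realise τ (fun ω => l * f ω + m * g ω) ω) 0 =
      l • fderiv ℝ (realise τ f ω) 0 + m • fderiv ℝ (realise τ g ω) 0 := by
    rw [realise_comb, fderiv_add (f := l • realise τ f ω) (g := m • realise τ g ω)
      ((memF_diff hf ω 0).const_smul l)
      ((memF_diff hg ω 0).const_smul m), fderiv_const_smul (memF_diff hf ω 0),
      fderiv_const_smul (memF_diff hg ω 0)]
  simp only [hfd]
  rw [norm_smul, norm_smul, Real.norm_of_nonneg hl.le, Real.norm_of_nonneg hm.le] at key
  have e1 : ∀ N F k : ℝ, 0 < k → 0 < F → (k * N) ^ 2 / (k * (8 * F)) = k * (N ^ 2 / (8 * F)) := by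
    intro N F k hk hF
    field_simp
  rw [e1 _ _ _ hl hfp, e1 _ _ _ hm hgp] at key
  rw [show 8 * (l * f ω + m * g ω) = l * (8 * f ω) + m * (8 * g ω) by ring]
  linarith

theorem trans_comb (hX : IsMDS P τ) {f g : Ω → ℝ}
    (hf : memF P τ f) (hg : memF P τ g) {l m : ℝ}
    (hl : 0 < l) (hm : 0 < m) (hlm : l + m = 1) {x y : Rd d} {φ ψ : Ω → Rd d}
    (hφ : memPhi P τ x φ) (hψ : memPhi P τ y ψ) :
    transport P τ (fun ω => l * f ω + m * g ω) (x + y) ≤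
      (∫ ω, ‖φ ω‖ ^ 2 / (2 * f ω) ∂P) / l + (∫ ω, ‖ψ ω‖ ^ 2 / (2 * g ω) ∂P) / m := by
  have hh := memF_comb hf hg hl hm hlm
  have hs := memPhi_add hφ hψ
  refine (csInf_le ⟨0, fun r hr => trans_nonneg hh hr⟩ ⟨_, hs, rfl⟩).trans ?_
  have i1 := (int_phi hX hf hφ).div_const l
  have i2 := (int_phi hX hg hψ).div_const m
  rw [← integral_div, ← integral_div, ← integral_add i1 i2]
  refine integral_mono (int_phi hX hh hs) (i1.add i2) fun ω => ?_
  have hfp := memF_pos hf ω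
  have hgp := memF_pos hg ω
  have key := aux_sq (φ ω) (ψ ω)
    (a := 2 * f ω * l) (b := 2 * g ω * m) (by positivity) (by positivity)
  simp only [Pi.add_apply, div_div]
  rw [show 2 * (l * f ω + m * g ω) = 2 * f ω * l + 2 * g ω * m by ring]
  exact key

end aux

/-- if `σ_s(0) = inf_{f ∈ 𝔽} 𝔼[|∇f|²/(8f) + Vf] > 0` then `Γ_V` is
subadditive. -/
theorem gamma_triangle {d : ℕ} {Ω : Type*} [MeasurableSpace Ω]
    (P : Measure Ω) (τ : Rd d → Ω → Ω) (hX : IsMDS P τ)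
    (V : Ω → ℝ) (hV : IsPotential P V)
    (hσ : 0 < sInf {r | ∃ f, memF P τ f ∧ r = energy P τ V f})
    (x y : Rd d) :
    Gamma P τ V (x + y) ≤ Gamma P τ V x + Gamma P τ V y := by
  have hFne : ∃ f, memF P τ f := by
    by_contra h
    have : {r | ∃ f, memF P τ f ∧ r = energy P τ V f} = ∅ := by
      ext r
      simp only [Set.mem_ofPred_eq, Set.mem_empty_iff_false, iff_false]
      rintro ⟨f, hf, -⟩
      exact h ⟨f, hf⟩
    rw [this, Real.sInf_empty] at hσ
    exact lt_irrefl _ hσ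
  obtain ⟨f0, hf0⟩ := hFne
  have hE : ∀ f, memF P τ f → 0 < energy P τ V f := fun f hf =>
    hσ.trans_le (csInf_le ⟨0, by rintro r ⟨g, hg, rfl⟩; exact energy_nonneg hV hg⟩ ⟨f, hf, rfl⟩)
  have hT : ∀ f, memF P τ f → ∀ z, 0 ≤ transport P τ f z := fun f hf z =>
    Real.sInf_nonneg fun r hr => trans_nonneg hf hr
  -- approximate minimisers
  have hA : ∀ f, memF P τ f → ∀ z, ∀ t, transport P τ f z < t →
      ∃ φ, memPhi P τ z φ ∧ (∫ ω, ‖φ ω‖ ^ 2 / (2 * f ω) ∂P) < t := by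
    intro f hf z t ht
    obtain ⟨r, ⟨φ, hφ, rfl⟩, hr⟩ := exists_lt_of_csInf_lt
      (s := {r | ∃ φ, memPhi P τ z φ ∧ r = ∫ ω, ‖φ ω‖ ^ 2 / (2 * f ω) ∂P})
      ⟨_, _, memPhi_const hX z, rfl⟩ ht
    exact ⟨φ, hφ, hr⟩
  have main : ∀ f, memF P τ f → ∀ g, memF P τ g →
      sInf {r | ∃ f, memF P τ f ∧ r = Real.sqrt (energy P τ V f * transport P τ f (x + y))} ≤
      Real.sqrt (energy P τ V f * transport P τ f x) +
        Real.sqrt (energy P τ V g * transport P τ g y) := by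
    intro f hf g hg
    refine le_of_forall_pos_le_add fun ε hε => ?_
    have hB : ∀ f, memF P τ f → ∀ z, transport P τ f z <
        (Real.sqrt (energy P τ V f * transport P τ f z) + ε / 2) ^ 2 / energy P τ V f := by
      intro f hf z
      rw [lt_div_iff₀ (hE f hf), mul_comm]
      have h0 := mul_nonneg (hE f hf).le (hT f hf z)
      nlinarith [Real.sq_sqrt h0, Real.sqrt_nonneg (energy P τ V f * transport P τ f z)]
    obtain ⟨φ, hφ, hφt⟩ := hA f hf x _ (hB f hf x)
    obtain ⟨ψ, hψ, hψt⟩ := hA g hg y _ (hB g hg y)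
    have hE1 := hE f hf
    have hE2 := hE g hg
    have hp0 : 0 < Real.sqrt (energy P τ V f * transport P τ f x) + ε / 2 := by positivity
    have hq0 : 0 < Real.sqrt (energy P τ V g * transport P τ g y) + ε / 2 := by positivity
    set p := Real.sqrt (energy P τ V f * transport P τ f x) + ε / 2 with hp
    set q := Real.sqrt (energy P τ V g * transport P τ g y) + ε / 2 with hq
    set a := energy P τ V f with ha
    set b := energy P τ V g with hb
    have hs : 0 < p / a + q / b := by positivity
    set s := p / a + q / b with hsd
    have hl : 0 < p / a / s := by positivity
    have hm : 0 < q / b / s := by positivity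
    have hlm : p / a / s + q / b / s = 1 := by
      rw [← add_div, ← hsd, div_self hs.ne']
    have hh := memF_comb hf hg hl hm hlm
    have k1 := energy_comb hX hV hf hg hl hm hlm
    have k2 := trans_comb hX hf hg hl hm hlm hφ hψ
    rw [← ha, ← hb] at k1
    have k3 : energy P τ V (fun ω => p / a / s * f ω + q / b / s * g ω) ≤ (p + q) / s := by
      refine k1.trans (le_of_eq ?_)
      field_simp
    have k4 : transport P τ (fun ω => p / a / s * f ω + q / b / s * g ω) (x + y) ≤
        (p + q) * s := by
      refine k2.trans ((add_le_add (div_le_div_of_nonneg_right hφt.le hl.le)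
        (div_le_div_of_nonneg_right hψt.le hm.le)).trans (le_of_eq ?_))
      clear_value s
      field_simp
    refine (csInf_le (s := {r | ∃ f, memF P τ f ∧
      r = Real.sqrt (energy P τ V f * transport P τ f (x + y))})
      ⟨0, by rintro r ⟨g, hg, rfl⟩; exact Real.sqrt_nonneg _⟩ ⟨_, hh, rfl⟩).trans ?_
    have : Real.sqrt (energy P τ V f * transport P τ f x) +
        Real.sqrt (energy P τ V g * transport P τ g y) + ε = p + q := by
      rw [hp, hq]; ring
    rw [this]
    refine Real.sqrt_le_iff.2 ⟨by positivity, ?_⟩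
    refine (mul_le_mul k3 k4 (hT _ hh _) (by positivity)).trans (le_of_eq ?_)
    clear_value s
    field_simp
  unfold Gamma
  rw [← mul_add]
  refine mul_le_mul_of_nonneg_left ?_ zero_le_two
  rw [← sub_le_iff_le_add]
  refine le_csInf ⟨_, f0, hf0, rfl⟩ ?_
  rintro r ⟨f, hf, rfl⟩
  rw [sub_le_comm]
  refine le_csInf ⟨_, f0, hf0, rfl⟩ ?_
  rintro r ⟨g, hg, rfl⟩
  rw [sub_le_iff_le_add']
  exact main f hf g hg
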